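/- Let A be a real n×n matrix, C a real m×n matrix, L and N real n×m matrices, θ a symmetric positive semidefinite real m×m matrix, and P a symmetric positive definite real n×n matrix such that (A − L*C)ᵀP + P*(A − L*C) is negative definite and P*N*C + Cᵀ*Nᵀ*P is negative semidefinite. Let e : ℝ → (Fin n → ℝ) be any solution of the cubic observer error dynamics e' = f(e), where f(e) = (A − L*C) *ᵥ e + (e ⬝ᵥ ((Cᵀ*θ*C) *ᵥ e)) • ((N*C) *ᵥ e). Then at every time t₀ with e(t₀) ≠ 0, the Lyapunov function V(t) = e(t) ⬝ᵥ (P *ᵥ e(t)) has strictly negative derivative at t₀. (Theorem 1: sufficient conditions (12)–(13) for global stability of the cubic observer error dynamics.) -/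

import Mathlib

open Matrix

/-- Product rule for the quadratic form `v ↦ v ⬝ᵥ P *ᵥ v` along a differentiable curve. -/
theorem hasDerivAt_dotProduct_mulVec_self {ι : Type*} [Fintype ι] (P : Matrix ι ι ℝ)
    {e : ℝ → ι → ℝ} {e' : ι → ℝ} {t : ℝ} (he : HasDerivAt e e' t) :
    HasDerivAt (fun s => e s ⬝ᵥ (P *ᵥ e s)) (e' ⬝ᵥ (P *ᵥ e t) + e t ⬝ᵥ (P *ᵥ e')) t := by
  have hc := hasDerivAt_pi.1 he
  have hP (i : ι) : HasDerivAt (fun s => (P *ᵥ e s) i) ((P *ᵥ e') i) t :=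
    HasDerivAt.fun_sum fun j _ => (hc j).const_mul (P i j)
  have h := HasDerivAt.fun_sum (u := Finset.univ) fun i _ => (hc i).fun_mul (hP i)
  rw [Finset.sum_add_distrib] at h
  exact h

/-- The quadratic form of the Lyapunov operator `Mᵀ P + P M`. -/
theorem dotProduct_lyapunov_mulVec {ι : Type*} [Fintype ι] (M P : Matrix ι ι ℝ) (v : ι → ℝ) :
    v ⬝ᵥ ((Mᵀ * P + P * M) *ᵥ v) = (M *ᵥ v) ⬝ᵥ (P *ᵥ v) + v ⬝ᵥ (P *ᵥ (M *ᵥ v)) := by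
  rw [add_mulVec, dotProduct_add, ← mulVec_mulVec, ← mulVec_mulVec, dotProduct_mulVec v Mᵀ,
    vecMul_transpose]

/-- Theorem 1: under conditions (12)–(13), along any solution of the cubic
observer error dynamics the Lyapunov function `V(t) = e(t)ᵀ P e(t)` has strictly
negative derivative whenever the error is nonzero. -/
theorem cubic_observer_thm1_lyapunov_decreasing {n m : ℕ}
    (A P : Matrix (Fin n) (Fin n) ℝ) (C : Matrix (Fin m) (Fin n) ℝ)
    (L N : Matrix (Fin n) (Fin m) ℝ) (θ : Matrix (Fin m) (Fin m) ℝ)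
    (hθsymm : θᵀ = θ)
    (hθpsd : ∀ w : Fin m → ℝ, 0 ≤ w ⬝ᵥ (θ *ᵥ w))
    (hPsymm : Pᵀ = P)
    (hPpos : ∀ v : Fin n → ℝ, v ≠ 0 → 0 < v ⬝ᵥ (P *ᵥ v))
    (hLyap : ∀ v : Fin n → ℝ, v ≠ 0 →
      v ⬝ᵥ (((A - L * C)ᵀ * P + P * (A - L * C)) *ᵥ v) < 0)
    (hNsd : ∀ v : Fin n → ℝ, v ⬝ᵥ ((P * N * C + Cᵀ * Nᵀ * P) *ᵥ v) ≤ 0)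
    (e : ℝ → (Fin n → ℝ))
    (hsol : ∀ t : ℝ, HasDerivAt e
      ((A - L * C) *ᵥ (e t) +
        ((e t) ⬝ᵥ ((Cᵀ * θ * C) *ᵥ (e t))) • ((N * C) *ᵥ (e t))) t) :
    ∀ t₀ : ℝ, e t₀ ≠ 0 →
      deriv (fun t => (e t) ⬝ᵥ (P *ᵥ (e t))) t₀ < 0 := by
  intro t ht
  rw [(hasDerivAt_dotProduct_mulVec_self P (hsol t)).deriv]
  have hθ : 0 ≤ e t ⬝ᵥ ((Cᵀ * θ * C) *ᵥ e t) := by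
    have h := hθpsd (C *ᵥ e t)
    rwa [← vecMul_transpose, ← dotProduct_mulVec, vecMul_transpose, mulVec_mulVec,
      mulVec_mulVec] at h
  have hA := hLyap (e t) ht
  rw [dotProduct_lyapunov_mulVec] at hA
  have hN := hNsd (e t)
  rw [add_comm, Matrix.mul_assoc P, ← transpose_mul, dotProduct_lyapunov_mulVec] at hN
  simp only [mulVec_add, mulVec_smul, add_dotProduct, dotProduct_add, smul_dotProduct,
    dotProduct_smul, smul_eq_mul]
  linarith [mul_nonpos_of_nonneg_of_nonpos hθ hN]
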